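/- Let f be a completely monotone function such that f′ varies regularly at infinity with index −ρ−1 for some 0 ≤ ρ ≤ 1, and assume the representing measure of f has a non-increasing density ν(t). Then there exist constants 0 < c₁ ≤ c₂ such that c₁ (−t^{−2} f′(t^{−1})) ≤ ν(t) ≤ c₂ (−t^{−2} f′(t^{−1})) for all t ∈ (0,1). -/

import Mathlib

open MeasureTheory Filter Set Topology

noncomputable section

/-- `f` is completely monotone on `(0,∞)`:
it is `C^∞` there and `(-1)^n f^{(n)}(l) ≥ 0` for all `n ≥ 0`, `l > 0`. -/
def CompMono (f : ℝ → ℝ) : Prop :=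
  ContDiffOn ℝ (⊤ : ℕ∞) f (Set.Ioi (0:ℝ)) ∧
  ∀ (n : ℕ) (l : ℝ), 0 < l → 0 ≤ (-1 : ℝ) ^ n * iteratedDeriv n f l

/-- `ν` is the representing measure of `f`: a measure on `[0,∞)`
with `f l = ∫ e^{-l t} ν(dt)` for all `l > 0`. -/
def IsRepMeasure (f : ℝ → ℝ) (ν : Measure ℝ) : Prop :=
  ν {t : ℝ | t < 0} = 0 ∧
  ∀ l : ℝ, 0 < l →
    MeasureTheory.Integrable (fun t : ℝ => Real.exp (-(l * t))) ν ∧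
    f l = ∫ t : ℝ, Real.exp (-(l * t)) ∂ν

/-- Condition (A-1): the measure `ν` has density `dens` (a positive function on `(0,∞)`)
with respect to Lebesgue measure. -/
def HasDensity (ν : Measure ℝ) (dens : ℝ → ℝ) : Prop :=
  (∀ t : ℝ, 0 < t → 0 < dens t) ∧
  ν = (volume.restrict (Set.Ioi (0:ℝ))).withDensity (fun t => ENNReal.ofReal (dens t))

/-- The right-limit `f^{(n)}(0+)` (junk value if it does not exist). -/
def dplus (f : ℝ → ℝ) (n : ℕ) : ℝ :=
  limUnder (nhdsWithin 0 (Set.Ioi (0:ℝ))) (iteratedDeriv n f)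

/-- All the right-limits `f^{(n)}(0+)` exist (as finite reals). -/
def DerivsFinite (f : ℝ → ℝ) : Prop :=
  ∀ n : ℕ, Filter.Tendsto (iteratedDeriv n f) (nhdsWithin 0 (Set.Ioi (0:ℝ))) (nhds (dplus f n))

/-- The terms of the series `∑ f^{(n)}(0+)/n! · (-l)^n`. -/
def tser (f : ℝ → ℝ) (l : ℝ) : ℕ → ℝ :=
  fun n => dplus f n / (n.factorial : ℝ) * (-l) ^ n

/-- `ω` is the abscissa `ω₀` of `f`: if all `f^{(n)}(0+)` are finite then `ω` is the
infimum of the set where `∑ f^{(n)}(0+)/n! (-l)^n` converges, otherwise `ω = 0`.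
(That a real `ω` satisfies this encodes `ω₀ > -∞`.) -/
def IsAbscissa (f : ℝ → ℝ) (ω : ℝ) : Prop :=
  (DerivsFinite f → IsGLB {l : ℝ | Summable (tser f l)} ω) ∧
  (¬ DerivsFinite f → ω = 0)

/-- `fe` is the extension `f_e` of `f` to `(ω,∞)`: it equals `f` on `(0,∞)` and the
series `∑ f^{(n)}(0+)/n! (-l)^n` on `(ω,0]`. -/
def IsExtension (f fe : ℝ → ℝ) (ω : ℝ) : Prop :=
  (∀ l : ℝ, 0 < l → fe l = f l) ∧
  (∀ l : ℝ, ω < l → l ≤ 0 → fe l = ∑' n : ℕ, tser f l n)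

/-- Condition (A-2) (monotonicity part): `t ↦ e^{-ω t} t⁻¹ dens t` is non-increasing on `(0,∞)`. -/
def CondA2 (dens : ℝ → ℝ) (ω : ℝ) : Prop :=
  ∀ s t : ℝ, 0 < s → s ≤ t →
    Real.exp (-(ω * t)) * t⁻¹ * dens t ≤ Real.exp (-(ω * s)) * s⁻¹ * dens s

/-- `φ` is a Bernstein function: nonnegative, `C^∞` on `(0,∞)` and
`(-1)^{n-1} φ^{(n)} ≥ 0` for all `n ≥ 1`. -/
def Bernstein (φ : ℝ → ℝ) : Prop :=
  ContDiffOn ℝ (⊤ : ℕ∞) φ (Set.Ioi (0:ℝ)) ∧ (∀ l : ℝ, 0 < l → 0 ≤ φ l) ∧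
  ∀ (n : ℕ) (l : ℝ), 0 < l → 0 ≤ (-1 : ℝ) ^ n * iteratedDeriv (n + 1) φ l

/-- `(a, b, μ)` is the Lévy triple of the Bernstein function `φ`:
`φ(l) = a + b l + ∫_{(0,∞)} (1 - e^{-l t}) μ(dt)` with `a, b ≥ 0` and `∫ (1 ∧ t) μ(dt) < ∞`. -/
def HasLevyTriple (φ : ℝ → ℝ) (a b : ℝ) (μ : Measure ℝ) : Prop :=
  0 ≤ a ∧ 0 ≤ b ∧ μ {t : ℝ | t ≤ 0} = 0 ∧
  (∫⁻ t : ℝ, ENNReal.ofReal (min 1 t) ∂μ) < ⊤ ∧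
  ∀ l : ℝ, 0 < l →
    MeasureTheory.Integrable (fun t : ℝ => 1 - Real.exp (-(l * t))) μ ∧
    φ l = a + b * l + ∫ t : ℝ, (1 - Real.exp (-(l * t))) ∂μ

/-- `h` is a complete Bernstein function: a Bernstein function whose Lévy measure
has a completely monotone density. -/
def IsCBF (h : ℝ → ℝ) : Prop :=
  Bernstein h ∧ ∃ (a b : ℝ) (μ : Measure ℝ) (ρ : ℝ → ℝ),
    HasLevyTriple h a b μ ∧ CompMono ρ ∧ HasDensity μ ρ

end


/-- Derivative formula and integrability. -/
lemma aux_rep (f dens : ℝ → ℝ) (ν : MeasureTheory.Measure ℝ)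
    (hν : IsRepMeasure f ν) (hA1 : HasDensity ν dens)
    (hmono : ∀ s t : ℝ, 0 < s → s ≤ t → dens t ≤ dens s) (l : ℝ) (hl : 0 < l) :
    IntegrableOn (fun s => dens s * (s * Real.exp (-(l * s)))) (Ioi 0) ∧
    -deriv f l = ∫ s in Ioi (0:ℝ), dens s * (s * Real.exp (-(l * s))) := by
  obtain ⟨hdp, hd⟩ := hA1
  have hsub : Iio (0:ℝ) ⊆ ProbabilityTheory.integrableExpSet (fun t : ℝ => t) ν := by
    intro x hx
    have := (hν.2 (-x) (by simpa using hx)).1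
    simpa [ProbabilityTheory.integrableExpSet] using this
  have hmem : -l ∈ interior (ProbabilityTheory.integrableExpSet (fun t : ℝ => t) ν) :=
    interior_maximal hsub isOpen_Iio (by simpa using hl)
  have hder := ProbabilityTheory.hasDerivAt_mgf hmem
  have hint := ProbabilityTheory.integrable_pow_mul_exp_of_mem_interior_integrableExpSet hmem 1
  have hcomp : HasDerivAt (fun y => ProbabilityTheory.mgf (fun t : ℝ => t) ν (-y))
      ((∫ t, t * Real.exp (-l * t) ∂ν) * (-1)) l :=
    HasDerivAt.comp l hder (hasDerivAt_neg l)
  have heq : f =ᶠ[𝓝 l] (fun y => ProbabilityTheory.mgf (fun t : ℝ => t) ν (-y)) := by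
    filter_upwards [Ioi_mem_nhds hl] with y hy
    rw [(hν.2 y hy).2]
    simp [ProbabilityTheory.mgf]
  have hdf : deriv f l = (∫ t, t * Real.exp (-l * t) ∂ν) * (-1) := by
    rw [heq.deriv_eq, hcomp.deriv]
  have hae : AEMeasurable (fun t => ENNReal.ofReal (dens t)) (volume.restrict (Ioi (0:ℝ))) := by
    apply AEMeasurable.ennreal_ofReal
    exact aemeasurable_restrict_of_antitoneOn measurableSet_Ioi
      (fun a ha b _ hab => hmono a b ha hab)
  have hlt : ∀ᵐ t ∂(volume.restrict (Ioi (0:ℝ))), ENNReal.ofReal (dens t) < ⊤ := by simp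
  have hae2 : (fun t => (ENNReal.ofReal (dens t)).toReal • (t * Real.exp (-l * t)))
      =ᵐ[volume.restrict (Ioi (0:ℝ))] (fun s => dens s * (s * Real.exp (-(l * s)))) := by
    filter_upwards [ae_restrict_mem measurableSet_Ioi] with s hs
    rw [ENNReal.toReal_ofReal (hdp s hs).le]
    simp
  constructor
  · rw [hd, integrable_withDensity_iff_integrable_smul₀' hae hlt] at hint
    simp only [pow_one] at hint
    exact hint.congr hae2
  · rw [hdf, hd, integral_withDensity_eq_integral_toReal_smul₀ hae hlt, integral_congr_ae hae2]
    ring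

lemma aux_gamma (l : ℝ) (hl : 0 < l) :
    IntegrableOn (fun s => s * Real.exp (-(l * s))) (Ioi 0) ∧
    ∫ s in Ioi (0:ℝ), s * Real.exp (-(l * s)) = 1 / l ^ 2 := by
  constructor
  · have := integrableOn_rpow_mul_exp_neg_mul_rpow (p := 1) (s := 1) (b := l)
      (by norm_num) (by norm_num) hl
    simpa using this
  · have := Real.integral_rpow_mul_exp_neg_mul_Ioi (a := 2) (r := l) (by norm_num) hl
    norm_num at this
    rw [this]
    norm_num

/-- Corollary 1.7 (regular variation at infinity): if `-f'` varies regularly at infinity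
with index `-ρ-1` (`0 ≤ ρ ≤ 1`) and the representing measure has a non-increasing density
`dens`, then `dens t ≍ -t^{-2} f'(t⁻¹)` on `(0,1)`. -/
theorem stmt_3 (f dens : ℝ → ℝ) (ν : MeasureTheory.Measure ℝ) (ρ : ℝ)
    (hf : CompMono f) (hν : IsRepMeasure f ν) (hA1 : HasDensity ν dens)
    (hmono : ∀ s t : ℝ, 0 < s → s ≤ t → dens t ≤ dens s)
    (hρ0 : 0 ≤ ρ) (hρ1 : ρ ≤ 1)
    (hpos : ∀ l : ℝ, 0 < l → deriv f l < 0)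
    (hreg : ∀ x : ℝ, 0 < x →
      Filter.Tendsto (fun l : ℝ => (-deriv f (l * x)) / (-deriv f l)) Filter.atTop
        (nhds (x ^ (-ρ - 1)))) :
    ∃ c₁ c₂ : ℝ, 0 < c₁ ∧ c₁ ≤ c₂ ∧ ∀ t : ℝ, 0 < t → t < 1 →
      c₁ * (-(deriv f t⁻¹) / t ^ 2) ≤ dens t ∧
      dens t ≤ c₂ * (-(deriv f t⁻¹) / t ^ 2) := by
  have hrep := aux_rep f dens ν hν hA1 hmono
  have hdp := hA1.1
  have hanti : ∀ a b : ℝ, 0 < a → a ≤ b → -deriv f b ≤ -deriv f a := by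
    intro a b ha hab
    rw [(hrep a ha).2, (hrep b (ha.trans_le hab)).2]
    refine setIntegral_mono_on (hrep b (ha.trans_le hab)).1 (hrep a ha).1 measurableSet_Ioi ?_
    intro s hs
    have hs : 0 < s := hs
    have := hdp s hs
    gcongr
  have hupper : ∀ t : ℝ, 0 < t → dens t * (Real.exp (-1) * (t ^ 2 / 2)) ≤ -deriv f t⁻¹ := by
    intro t ht
    have htt : 0 < t⁻¹ := inv_pos.mpr ht
    have h1 : ∫ s in Ioc (0:ℝ) t, dens s * (s * Real.exp (-(t⁻¹ * s))) ≤ -deriv f t⁻¹ := by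
      rw [(hrep _ htt).2]
      refine setIntegral_mono_set (hrep _ htt).1 ?_ Ioc_subset_Ioi_self.eventuallyLE
      filter_upwards [ae_restrict_mem measurableSet_Ioi] with s hs
      have hs : 0 < s := hs
      have := hdp s hs
      simp only [Pi.zero_apply]
      positivity
    have h2 : ∫ s in Ioc (0:ℝ) t, (dens t * Real.exp (-1)) * s
        ≤ ∫ s in Ioc (0:ℝ) t, dens s * (s * Real.exp (-(t⁻¹ * s))) := by
      refine setIntegral_mono_on ?_ ((hrep _ htt).1.mono_set Ioc_subset_Ioi_self)
        measurableSet_Ioc ?_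
      · exact (continuous_const.mul continuous_id).integrableOn_Ioc
      · intro s hs
        have h3 := hmono s t hs.1 hs.2
        have h4 : Real.exp (-1) ≤ Real.exp (-(t⁻¹ * s)) := by
          apply Real.exp_le_exp.mpr
          have : t⁻¹ * s ≤ t⁻¹ * t := by
            have := hs.2
            gcongr
          rw [inv_mul_cancel₀ ht.ne'] at this
          linarith
        have hs0 := hs.1
        have := hdp s hs0
        have := hdp t ht
        calc dens t * Real.exp (-1) * s ≤ dens s * Real.exp (-(t⁻¹ * s)) * s := by gcongr
          _ = _ := by ring
    rw [integral_const_mul, ← intervalIntegral.integral_of_le ht.le, integral_id] at h2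
    calc _ = dens t * Real.exp (-1) * ((t ^ 2 - 0 ^ 2) / 2) := by ring
      _ ≤ _ := h2.trans h1
  have hlower : ∀ l : ℝ, 0 < l → -deriv f l ≤
      Real.exp 1 * (-deriv f (l * 20)) + dens (19 * l)⁻¹ * (1 / l ^ 2) := by
    intro l hl
    have hl20 : 0 < l * 20 := by positivity
    have ht : 0 < (19 * l)⁻¹ := by positivity
    rw [(hrep l hl).2, (hrep _ hl20).2, ← (aux_gamma l hl).2, ← integral_const_mul,
      ← integral_const_mul, ← integral_add ((hrep _ hl20).1.const_mul _)
        ((aux_gamma l hl).1.const_mul _)]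
    refine setIntegral_mono_on (hrep l hl).1 (((hrep _ hl20).1.const_mul _).add
        ((aux_gamma l hl).1.const_mul _)) measurableSet_Ioi ?_
    intro s hs
    have hs : 0 < s := hs
    have hds := hdp s hs
    have hdt := hdp _ ht
    rcases le_total s (19 * l)⁻¹ with h | h
    · have h5 : 19 * l * s ≤ 1 := by
        calc 19 * l * s ≤ 19 * l * (19 * l)⁻¹ := by gcongr
          _ = 1 := mul_inv_cancel₀ (by positivity)
      have h6 : Real.exp (-(l * s)) ≤ Real.exp 1 * Real.exp (-(l * 20 * s)) := by
        rw [← Real.exp_add]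
        apply Real.exp_le_exp.mpr
        linarith
      have h7 : 0 ≤ dens (19 * l)⁻¹ * (s * Real.exp (-(l * s))) := by positivity
      calc dens s * (s * Real.exp (-(l * s)))
          ≤ dens s * (s * (Real.exp 1 * Real.exp (-(l * 20 * s)))) := by gcongr
        _ = Real.exp 1 * (dens s * (s * Real.exp (-(l * 20 * s)))) := by ring
        _ ≤ _ := by linarith
    · have h8 := hmono _ s ht h
      have h7 : 0 ≤ Real.exp 1 * (dens s * (s * Real.exp (-(l * 20 * s)))) := by positivity
      have h9 : dens s * (s * Real.exp (-(l * s)))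
          ≤ dens (19 * l)⁻¹ * (s * Real.exp (-(l * s))) := by gcongr
      linarith
  have hev : ∀ᶠ l : ℝ in atTop, (-deriv f (l * 20)) / (-deriv f l) < 1 / 10 := by
    apply (hreg 20 (by norm_num)).eventually_lt_const
    calc (20:ℝ) ^ (-ρ - 1) ≤ (20:ℝ) ^ (-1 : ℝ) :=
          Real.rpow_le_rpow_of_exponent_le (by norm_num) (by linarith)
      _ < 1 / 10 := by rw [Real.rpow_neg_one]; norm_num
  obtain ⟨L₀, hL₀⟩ := eventually_atTop.mp hev
  set L := max L₀ 1 with hLdef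
  have hL1 : 1 ≤ L := le_max_right _ _
  have hsmall : ∀ t : ℝ, 0 < t → t ≤ (19 * L)⁻¹ → -deriv f t⁻¹ / t ^ 2 ≤ 722 * dens t := by
    intro t ht htL
    have hl : 0 < (19 * t)⁻¹ := by positivity
    have hlL : L ≤ (19 * t)⁻¹ := by
      have h19 : 19 * L ≤ t⁻¹ := (le_inv_comm₀ ht (by positivity)).mp htL
      rw [mul_inv]
      linarith
    have h1 := hlower _ hl
    have h2 := hL₀ _ ((le_max_left _ _).trans hlL)
    rw [div_lt_iff₀ (by linarith [hpos _ hl])] at h2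
    have e1 : (19 * (19 * t)⁻¹)⁻¹ = t := by field_simp
    have e2 : 1 / ((19 * t)⁻¹) ^ 2 = 361 * t ^ 2 := by field_simp; norm_num
    rw [e1, e2] at h1
    have h3 := hanti (19 * t)⁻¹ t⁻¹ hl (by
      rw [mul_inv]; have : 0 < t⁻¹ := by positivity
      linarith)
    have he := Real.exp_one_lt_d9
    have hg := hpos _ hl
    have h4 : Real.exp 1 * (-deriv f ((19 * t)⁻¹ * 20)) ≤ 3 * (1 / 10 * (-deriv f (19 * t)⁻¹)) := by
      have := hpos ((19 * t)⁻¹ * 20) (by positivity)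
      apply mul_le_mul (by linarith) h2.le (by linarith) (by norm_num)
    rw [div_le_iff₀ (by positivity)]
    linarith
  have hd1 := hdp 1 one_pos
  have hg1 := hpos 1 one_pos
  set t₀ := (19 * L)⁻¹ with ht₀
  have ht₀pos : 0 < t₀ := by positivity
  have hGpos : 0 < -deriv f 1 / t₀ ^ 2 := div_pos (by linarith) (by positivity)
  refine ⟨min (1 / 722) (dens 1 / (-deriv f 1 / t₀ ^ 2)), 2 * Real.exp 1, ?_, ?_, ?_⟩
  · exact lt_min (by norm_num) (div_pos hd1 hGpos)
  · refine (min_le_left _ _).trans ?_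
    have := Real.add_one_le_exp (1:ℝ)
    linarith
  · intro t ht ht1
    have htt : 0 < t⁻¹ := inv_pos.mpr ht
    have hG : 0 < -deriv f t⁻¹ / t ^ 2 := div_pos (by linarith [hpos _ htt]) (by positivity)
    constructor
    · rcases le_total t t₀ with h | h
      · calc _ ≤ 1 / 722 * (-deriv f t⁻¹ / t ^ 2) := by
              gcongr
              exact min_le_left _ _
          _ ≤ dens t := by linarith [hsmall t ht h]
      · have h1 : -deriv f t⁻¹ / t ^ 2 ≤ -deriv f 1 / t₀ ^ 2 := by
          have := hanti 1 t⁻¹ one_pos ((one_le_inv₀ ht).mpr ht1.le)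
          apply div_le_div₀ (by linarith) this (by positivity)
          gcongr
        calc _ ≤ dens 1 / (-deriv f 1 / t₀ ^ 2) * (-deriv f 1 / t₀ ^ 2) := by
              apply mul_le_mul (min_le_right _ _) h1 hG.le
              exact (div_pos hd1 hGpos).le
          _ = dens 1 := div_mul_cancel₀ _ hGpos.ne'
          _ ≤ dens t := hmono t 1 ht ht1.le
    · have h1 := hupper t ht
      rw [← mul_div_assoc, le_div_iff₀ (by positivity)]
      have h2 : Real.exp 1 * Real.exp (-1) = 1 := by rw [← Real.exp_add]; simp
      calc dens t * t ^ 2 = (Real.exp 1 * Real.exp (-1)) * (dens t * t ^ 2) := by rw [h2, one_mul]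
        _ = 2 * Real.exp 1 * (dens t * (Real.exp (-1) * (t ^ 2 / 2))) := by ring
        _ ≤ _ := by gcongr
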